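/- Let Σ ∈ ℝ^{d×d} be symmetric positive definite with ‖Σ‖₂ ≤ 1 and ν = λ_min(Σ) > 0. Let J be a nonempty proper subset of {1,…,d} with complement K, let ν_J = λ_min(Σ_J), let β ∈ ℝ^d with β_K its restriction to K, let S⁽⁰⁾ ∈ ℝ^{|J|×|J|} be symmetric, and define the Neumann iterates S⁽ℓ⁾ = (I − Σ_J)S⁽ℓ⁻¹⁾ + I for ℓ ≥ 1. Then for every ℓ ≥ 0, (β_K)ᵀ Σ_{K,J} (S⁽ℓ⁾ − (Σ_J)⁻¹) Σ_J ((S⁽ℓ⁾)ᵀ − (Σ_J)⁻¹) Σ_{J,K} β_K ≤ (1/ν) (1 − ν_J)^{2ℓ} ‖β‖₂² ‖I − Σ_J S⁽⁰⁾‖₂². (Deterministic, per-missing-pattern form of the exponential decay of the approximation error of the order-ℓ Neumann approximation of the Bayes predictor, Proposition 3.) -/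

import Mathlib

open Matrix

/-- The ℓ²→ℓ² operator norm (largest singular value) of a real matrix. -/
noncomputable def l2OpNorm {m n : Type*} [Fintype m] [Fintype n] [DecidableEq n]
    (A : Matrix m n ℝ) : ℝ :=
  ‖LinearMap.toContinuousLinearMap (Matrix.toEuclideanLin A)‖

/-- The submatrix of `Σ` keeping rows indexed by `J` and columns indexed by `K`. -/
def subMat {d : ℕ} (Sig : Matrix (Fin d) (Fin d) ℝ) (J K : Finset (Fin d)) :
    Matrix {i // i ∈ J} {i // i ∈ K} ℝ :=
  Sig.submatrix (fun j => (j : Fin d)) (fun k => (k : Fin d))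

theorem mulVec_dotProduct_mulVec_le {m n : Type*} [Fintype m] [Fintype n] [DecidableEq n]
    (A : Matrix m n ℝ) (x : n → ℝ) :
    (A *ᵥ x) ⬝ᵥ (A *ᵥ x) ≤ l2OpNorm A ^ 2 * (x ⬝ᵥ x) := by
  have h := (LinearMap.toContinuousLinearMap (Matrix.toEuclideanLin A)).le_opNorm
    (WithLp.toLp 2 x)
  have h2 := pow_le_pow_left₀ (norm_nonneg _) h 2
  rw [mul_pow, EuclideanSpace.real_norm_sq_eq, EuclideanSpace.real_norm_sq_eq] at h2
  simpa [dotProduct, l2OpNorm, sq, Matrix.toEuclideanLin] using h2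

/-- Parseval's identity for the eigenvectors of a symmetric matrix. -/
theorem sum_eigenvectorBasis_sq {n : Type*} [Fintype n] [DecidableEq n] {A : Matrix n n ℝ}
    (hA : A.IsHermitian) (x : n → ℝ) :
    ∑ i, ((hA.eigenvectorBasis i).ofLp ⬝ᵥ x) ^ 2 = x ⬝ᵥ x := by
  have h := hA.eigenvectorBasis.sum_sq_norm_inner_right (WithLp.toLp 2 x)
  rw [EuclideanSpace.real_norm_sq_eq] at h
  simpa [PiLp.inner_apply, dotProduct, sq, mul_comm] using h

theorem eigenvectorBasis_dotProduct_mulVec {n : Type*} [Fintype n] [DecidableEq n]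
    {A : Matrix n n ℝ} (hA : A.IsHermitian) (x : n → ℝ) (i : n) :
    (hA.eigenvectorBasis i).ofLp ⬝ᵥ (A *ᵥ x) =
      hA.eigenvalues i * ((hA.eigenvectorBasis i).ofLp ⬝ᵥ x) := by
  have hT : Aᵀ = A := by simpa [Matrix.IsHermitian] using hA
  rw [dotProduct_mulVec, ← mulVec_transpose, hT, hA.mulVec_eigenvectorBasis, smul_dotProduct,
    smul_eq_mul]

theorem eigenvectorBasis_dotProduct_self {n : Type*} [Fintype n] [DecidableEq n]
    {A : Matrix n n ℝ} (hA : A.IsHermitian) (i : n) :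
    (hA.eigenvectorBasis i).ofLp ⬝ᵥ (hA.eigenvectorBasis i).ofLp = 1 := by
  have h : ‖hA.eigenvectorBasis i‖ ^ 2 = 1 := by simp
  rw [EuclideanSpace.real_norm_sq_eq] at h
  simpa [dotProduct, sq] using h

theorem mul_dotProduct_self_le_of_le_eigenvalues {n : Type*} [Fintype n] [DecidableEq n]
    {A : Matrix n n ℝ} (hA : A.IsHermitian) {c : ℝ} (hc : ∀ i, c ≤ hA.eigenvalues i)
    (x : n → ℝ) : c * (x ⬝ᵥ x) ≤ x ⬝ᵥ (A *ᵥ x) := by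
  have h : x ⬝ᵥ (A *ᵥ x) =
      ∑ i, hA.eigenvalues i * ((hA.eigenvectorBasis i).ofLp ⬝ᵥ x) ^ 2 := by
    have := hA.eigenvectorBasis.sum_inner_mul_inner (WithLp.toLp 2 x) (WithLp.toLp 2 (A *ᵥ x))
    simp only [EuclideanSpace.inner_eq_star_dotProduct, star_trivial] at this
    rw [dotProduct_comm, ← this]
    refine Finset.sum_congr rfl fun i _ => ?_
    rw [dotProduct_comm (A *ᵥ x), eigenvectorBasis_dotProduct_mulVec]
    ring
  rw [h, ← sum_eigenvectorBasis_sq hA, Finset.mul_sum]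
  exact Finset.sum_le_sum fun i _ => mul_le_mul_of_nonneg_right (hc i) (sq_nonneg _)

theorem one_sub_mulVec_dotProduct_self_le {n : Type*} [Fintype n] [DecidableEq n]
    {A : Matrix n n ℝ} (hA : A.IsHermitian) {c : ℝ} (hc : ∀ i, c ≤ hA.eigenvalues i)
    (h1 : ∀ i, hA.eigenvalues i ≤ 1) (x : n → ℝ) :
    ((1 - A) *ᵥ x) ⬝ᵥ ((1 - A) *ᵥ x) ≤ (1 - c) ^ 2 * (x ⬝ᵥ x) := by
  rw [← sum_eigenvectorBasis_sq hA x, ← sum_eigenvectorBasis_sq hA, Finset.mul_sum]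
  refine Finset.sum_le_sum fun i _ => ?_
  rw [sub_mulVec, one_mulVec, dotProduct_sub, eigenvectorBasis_dotProduct_mulVec, ← one_sub_mul,
    mul_pow]
  gcongr
  · linarith [h1 i]
  · exact hc i

theorem one_sub_pow_mulVec_dotProduct_self_le {n : Type*} [Fintype n] [DecidableEq n]
    {A : Matrix n n ℝ} (hA : A.IsHermitian) {c : ℝ} (hc : ∀ i, c ≤ hA.eigenvalues i)
    (h1 : ∀ i, hA.eigenvalues i ≤ 1) (x : n → ℝ) (l : ℕ) :
    ((1 - A) ^ l *ᵥ x) ⬝ᵥ ((1 - A) ^ l *ᵥ x) ≤ (1 - c) ^ (2 * l) * (x ⬝ᵥ x) := by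
  induction l with
  | zero => simp
  | succ l ih =>
    rw [pow_succ', ← mulVec_mulVec]
    calc _ ≤ (1 - c) ^ 2 * _ := one_sub_mulVec_dotProduct_self_le hA hc h1 _
      _ ≤ (1 - c) ^ 2 * ((1 - c) ^ (2 * l) * (x ⬝ᵥ x)) := by gcongr
      _ = _ := by ring

theorem dotProduct_inv_mulVec_le {n : Type*} [Fintype n] [DecidableEq n]
    {A : Matrix n n ℝ} (hdet : IsUnit A.det) {c : ℝ} (hc : 0 < c)
    (hA : ∀ x : n → ℝ, c * (x ⬝ᵥ x) ≤ x ⬝ᵥ (A *ᵥ x)) (x : n → ℝ) :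
    x ⬝ᵥ (A⁻¹ *ᵥ x) ≤ 1 / c * (x ⬝ᵥ x) := by
  have h := hA (A⁻¹ *ᵥ x)
  rw [mulVec_mulVec, mul_nonsing_inv _ hdet, one_mulVec, dotProduct_comm _ x] at h
  set y := A⁻¹ *ᵥ x
  have h2 : 0 ≤ (x - c • y) ⬝ᵥ (x - c • y) :=
    Finset.sum_nonneg fun i _ => mul_self_nonneg _
  simp only [sub_dotProduct, dotProduct_sub, smul_dotProduct, dotProduct_smul, smul_eq_mul,
    dotProduct_comm y x] at h2
  rw [div_mul_eq_mul_div, one_mul, le_div_iff₀ hc]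
  nlinarith

/-- Extension by zero of a vector indexed by a subset. -/
noncomputable def zeroExtend {d : ℕ} (K : Finset (Fin d)) (x : {i // i ∈ K} → ℝ) :
    Fin d → ℝ :=
  fun i => if h : i ∈ K then x ⟨i, h⟩ else 0

theorem dotProduct_zeroExtend {d : ℕ} (K : Finset (Fin d)) (x : {i // i ∈ K} → ℝ)
    (v : Fin d → ℝ) : v ⬝ᵥ zeroExtend K x = (fun k : {i // i ∈ K} => v k) ⬝ᵥ x := by
  simp only [dotProduct, zeroExtend]
  rw [← Finset.sum_subset (Finset.subset_univ K) fun i _ hi => by simp [hi],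
    ← Finset.sum_coe_sort K]
  exact Finset.sum_congr rfl fun i _ => by simp

theorem zeroExtend_dotProduct_self {d : ℕ} (K : Finset (Fin d)) (x : {i // i ∈ K} → ℝ) :
    zeroExtend K x ⬝ᵥ zeroExtend K x = x ⬝ᵥ x := by
  rw [dotProduct_zeroExtend]
  simp [zeroExtend]

theorem subMat_mulVec {d : ℕ} (Sig : Matrix (Fin d) (Fin d) ℝ) (J K : Finset (Fin d))
    (x : {i // i ∈ K} → ℝ) :
    subMat Sig J K *ᵥ x = fun j : {i // i ∈ J} => (Sig *ᵥ zeroExtend K x) j := by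
  ext j
  exact (dotProduct_zeroExtend K x (Sig j)).symm

theorem dotProduct_subMat_mulVec {d : ℕ} (Sig : Matrix (Fin d) (Fin d) ℝ)
    (J : Finset (Fin d)) (x : {i // i ∈ J} → ℝ) :
    x ⬝ᵥ (subMat Sig J J *ᵥ x) = zeroExtend J x ⬝ᵥ (Sig *ᵥ zeroExtend J x) := by
  rw [subMat_mulVec, dotProduct_comm, dotProduct_comm (zeroExtend J x), dotProduct_zeroExtend]

theorem sum_coe_mul_self_le {d : ℕ} (J : Finset (Fin d)) (v : Fin d → ℝ) :
    (fun j : {i // i ∈ J} => v j) ⬝ᵥ (fun j : {i // i ∈ J} => v j) ≤ v ⬝ᵥ v := by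
  simp only [dotProduct]
  rw [Finset.sum_coe_sort J fun i => v i * v i]
  exact Finset.sum_le_sum_of_subset_of_nonneg (Finset.subset_univ J)
    fun i _ _ => mul_self_nonneg _

theorem subMat_mulVec_dotProduct_self_le {d : ℕ} {Sig : Matrix (Fin d) (Fin d) ℝ}
    (hnorm : l2OpNorm Sig ≤ 1) (J K : Finset (Fin d)) (x : {i // i ∈ K} → ℝ) :
    (subMat Sig J K *ᵥ x) ⬝ᵥ (subMat Sig J K *ᵥ x) ≤ x ⬝ᵥ x := by
  have h0 : 0 ≤ l2OpNorm Sig := norm_nonneg _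
  have hx : 0 ≤ x ⬝ᵥ x := Finset.sum_nonneg fun i _ => mul_self_nonneg _
  rw [subMat_mulVec]
  refine (sum_coe_mul_self_le J _).trans ((mulVec_dotProduct_mulVec_le _ _).trans ?_)
  rw [zeroExtend_dotProduct_self]
  exact mul_le_of_le_one_left hx (pow_le_one₀ h0 hnorm)

theorem eigenvalues_subMat_le_one {d : ℕ} {Sig : Matrix (Fin d) (Fin d) ℝ}
    (hnorm : l2OpNorm Sig ≤ 1) {J : Finset (Fin d)} (hJ : (subMat Sig J J).IsHermitian)
    (i : {i // i ∈ J}) : hJ.eigenvalues i ≤ 1 := by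
  have h := subMat_mulVec_dotProduct_self_le hnorm J J (hJ.eigenvectorBasis i).ofLp
  rw [hJ.mulVec_eigenvectorBasis, smul_dotProduct, dotProduct_smul,
    eigenvectorBasis_dotProduct_self] at h
  simp only [smul_eq_mul, mul_one] at h
  nlinarith

/-- The error of the Neumann iterates is geometric. -/
theorem neumann_sub_inv {n : Type*} [Fintype n] [DecidableEq n] {A : Matrix n n ℝ}
    (hdet : IsUnit A.det) {S : ℕ → Matrix n n ℝ}
    (hrec : ∀ l : ℕ, S (l + 1) = (1 - A) * S l + 1) (l : ℕ) :
    S l - A⁻¹ = (1 - A) ^ l * (S 0 - A⁻¹) := by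
  induction l with
  | zero => simp
  | succ l ih =>
    rw [pow_succ', mul_assoc, ← ih, hrec, mul_sub, sub_mul 1 A A⁻¹, mul_nonsing_inv _ hdet,
      one_mul]
    abel

/-- **Deterministic, per-missing-pattern form of the exponential decay of the
approximation error of the order-ℓ Neumann approximation of the Bayes predictor
(Proposition 3).**  Let `Σ` be symmetric positive definite with `‖Σ‖₂ ≤ 1` and
smallest eigenvalue `ν > 0`, `J` a nonempty proper subset of `{1,…,d}` with
complement `K`, `ν_J = λ_min(Σ_J)`, `β ∈ ℝ^d` with restriction `β_K`, `S⁰`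
symmetric, and `Sℓ = (I − Σ_J)Sℓ₋₁ + I` the Neumann iterates.  Then for all `ℓ`,
`β_Kᵀ Σ_{K,J} (Sℓ − Σ_J⁻¹) Σ_J (Sℓᵀ − Σ_J⁻¹) Σ_{J,K} β_K
  ≤ (1/ν) (1 − ν_J)^{2ℓ} ‖β‖₂² ‖I − Σ_J S⁰‖₂²`. -/
theorem stmt_15 {d : ℕ} (Sig : Matrix (Fin d) (Fin d) ℝ) (hSig : Sig.PosDef)
    (hnorm : l2OpNorm Sig ≤ 1)
    (ν : ℝ) (hν : 0 < ν)
    (hνmem : ∃ i, hSig.1.eigenvalues i = ν)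
    (hνmin : ∀ i, ν ≤ hSig.1.eigenvalues i)
    (J : Finset (Fin d)) (hJ : J.Nonempty) (hJproper : J ≠ Finset.univ)
    (hSigJ : (subMat Sig J J).IsHermitian)
    (νJ : ℝ) (hνJmem : ∃ i, hSigJ.eigenvalues i = νJ)
    (hνJmin : ∀ i, νJ ≤ hSigJ.eigenvalues i)
    (β : Fin d → ℝ) (βK : {i // i ∈ Jᶜ} → ℝ) (hβK : ∀ k, βK k = β k)
    (S : ℕ → Matrix {i // i ∈ J} {i // i ∈ J} ℝ) (hS0 : (S 0)ᵀ = S 0)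
    (hrec : ∀ ℓ : ℕ, S (ℓ + 1) = (1 - subMat Sig J J) * S ℓ + 1) :
    ∀ ℓ : ℕ,
      βK ⬝ᵥ ((subMat Sig Jᶜ J * (S ℓ - (subMat Sig J J)⁻¹) * subMat Sig J J *
          ((S ℓ)ᵀ - (subMat Sig J J)⁻¹) * subMat Sig J Jᶜ) *ᵥ βK) ≤
        (1 / ν) * (1 - νJ) ^ (2 * ℓ) * (∑ i, β i ^ 2) *
          (l2OpNorm (1 - subMat Sig J J * S 0)) ^ 2 := by
  intro l
  set A := subMat Sig J J with hA
  have hAT : Aᵀ = A := by simpa [Matrix.IsHermitian] using hSigJ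
  have hquad : ∀ x : {i // i ∈ J} → ℝ, ν * (x ⬝ᵥ x) ≤ x ⬝ᵥ (A *ᵥ x) := fun x => by
    rw [hA, dotProduct_subMat_mulVec, ← zeroExtend_dotProduct_self]
    exact mul_dotProduct_self_le_of_le_eigenvalues hSig.1 hνmin _
  have hdet : IsUnit A.det :=
    ((hSig.submatrix Subtype.val_injective : A.PosDef).det_pos).ne'.isUnit
  have hSigT : Sigᵀ = Sig := by simpa [Matrix.IsHermitian] using hSig.1
  have hKJ : subMat Sig Jᶜ J = (subMat Sig J Jᶜ)ᵀ := by
    rw [subMat, subMat, transpose_submatrix, hSigT]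
  set u := subMat Sig J Jᶜ *ᵥ βK with hu
  set E := 1 - A * S 0 with hE
  set w := E *ᵥ ((1 - A) ^ l *ᵥ u) with hw
  have herr : (S l)ᵀ - A⁻¹ = -(A⁻¹ * E * (1 - A) ^ l) := by
    have h := congrArg transpose (neumann_sub_inv hdet hrec l)
    rw [transpose_sub, transpose_mul, transpose_sub, transpose_pow, transpose_sub, transpose_one,
      transpose_nonsing_inv, hAT, hS0] at h
    rw [h, hE, mul_sub, ← mul_assoc, nonsing_inv_mul _ hdet, mul_one, one_mul, ← neg_mul, neg_sub]
  have herrT : S l - A⁻¹ = ((S l)ᵀ - A⁻¹)ᵀ := by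
    rw [transpose_sub, transpose_transpose, transpose_nonsing_inv, hAT]
  have hvec : ((S l)ᵀ - A⁻¹) *ᵥ u = -(A⁻¹ *ᵥ w) := by
    simp only [herr, neg_mulVec, hw, ← mulVec_mulVec]
  have key : βK ⬝ᵥ ((subMat Sig Jᶜ J * (S l - A⁻¹) * A *
      ((S l)ᵀ - A⁻¹) * subMat Sig J Jᶜ) *ᵥ βK) = w ⬝ᵥ (A⁻¹ *ᵥ w) := by
    rw [hKJ, herrT]
    simp only [← mulVec_mulVec]
    rw [← hu, hvec, dotProduct_mulVec, vecMul_transpose, ← hu, dotProduct_mulVec,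
      vecMul_transpose, hvec, mulVec_neg, mulVec_mulVec w A, mul_nonsing_inv _ hdet, one_mulVec,
      neg_dotProduct_neg, dotProduct_comm]
  have hub : u ⬝ᵥ u ≤ ∑ i, β i ^ 2 := by
    refine (subMat_mulVec_dotProduct_self_le hnorm J Jᶜ βK).trans ?_
    have h := sum_coe_mul_self_le Jᶜ β
    rw [← funext hβK] at h
    simpa [dotProduct, sq] using h
  rw [key]
  calc w ⬝ᵥ (A⁻¹ *ᵥ w) ≤ 1 / ν * (w ⬝ᵥ w) := dotProduct_inv_mulVec_le hdet hν hquad w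
    _ ≤ 1 / ν * (l2OpNorm E ^ 2 * ((1 - νJ) ^ (2 * l) * ∑ i, β i ^ 2)) := by
      refine mul_le_mul_of_nonneg_left ?_ (by positivity)
      refine (mulVec_dotProduct_mulVec_le E _).trans
        (mul_le_mul_of_nonneg_left ?_ (sq_nonneg _))
      refine (one_sub_pow_mulVec_dotProduct_self_le hSigJ hνJmin
        (eigenvalues_subMat_le_one hnorm hSigJ) u l).trans ?_
      exact mul_le_mul_of_nonneg_left hub ((even_two_mul l).pow_nonneg _)
    _ = _ := by ring
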